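/- Let m ≥ 3 and let U ⊆ ℝ^m be a domain. Let F⃗ = (F₁,...,F_m) be a C¹ vector field and u, v C² functions on U such that ∇u + F⃗ ≠ 0 and ∇v + F⃗ ≠ 0 everywhere on U. Suppose H_F(u) ≤ H_F(v) in U, u ≥ v in U, and u = v at some point p₀ ∈ U. Let N₁^⊥(v),...,N_{m−1}^⊥(v) be a C^∞ orthonormal frame of the orthogonal complement of N_F(v) on U, written N_α^⊥(v) = Σ_{k=1}^m b_α^k ∂_k. Assume there exists a pair (α,β) with α ≠ β such that Σ_{k<j}(∂_k F_j − ∂_j F_k)(b_α^k b_β^j − b_α^j b_β^k) ≠ 0 at every point of U (or the analogous condition for the frame associated to u). Then u ≡ v in U. -/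

import Mathlib

open Set Finset

noncomputable section

/-- The `k`-th standard basis vector of `ℝ^N` (zero if `k ≥ N`). -/
def ee (N k : ℕ) : Fin N → ℝ := fun i => if (i : ℕ) = k then 1 else 0

/-- The `k`-th partial derivative. -/
def pd (N k : ℕ) (f : (Fin N → ℝ) → ℝ) (x : Fin N → ℝ) : ℝ := fderiv ℝ f x (ee N k)

/-- `∇u + F`. -/
def gradF (N : ℕ) (F : (Fin N → ℝ) → (Fin N → ℝ)) (u : (Fin N → ℝ) → ℝ)
    (x : Fin N → ℝ) : Fin N → ℝ :=
  fun i => pd N i u x + F x i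

/-- The Legendrian (horizontal) normal `N_F(u) = (∇u + F)/|∇u + F|`. -/
def legN (N : ℕ) (F : (Fin N → ℝ) → (Fin N → ℝ)) (u : (Fin N → ℝ) → ℝ)
    (x : Fin N → ℝ) : Fin N → ℝ :=
  fun i => gradF N F u x i / Real.sqrt (∑ k, (gradF N F u x k) ^ 2)

/-- The horizontal (p-)mean curvature `H_F(u) = div N_F(u)`. -/
def Hmc (N : ℕ) (F : (Fin N → ℝ) → (Fin N → ℝ)) (u : (Fin N → ℝ) → ℝ)
    (x : Fin N → ℝ) : ℝ :=
  ∑ i : Fin N, pd N (i : ℕ) (fun y => legN N F u y i) x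

/-- `Nw` is a smooth orthonormal frame on `U` of the orthogonal complement of the
Legendrian normal `N_F(w)`. -/
def OrthFrame (m : ℕ) (U : Set (Fin m → ℝ)) (F : (Fin m → ℝ) → (Fin m → ℝ))
    (w : (Fin m → ℝ) → ℝ) (Nw : Fin (m - 1) → ((Fin m → ℝ) → (Fin m → ℝ))) : Prop :=
  (∀ α, ContDiffOn ℝ (⊤ : ℕ∞) (Nw α) U) ∧
  (∀ x ∈ U, ∀ α β, (∑ i, Nw α x i * Nw β x i) = if α = β then 1 else 0) ∧
  (∀ x ∈ U, ∀ α, (∑ i, Nw α x i * legN m F w x i) = 0)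

/-- `Σ_{k<j}(∂_k F_j − ∂_j F_k)(b_α^k b_β^j − b_α^j b_β^k)` for the frame `Nw`. -/
def curlPairing (m : ℕ) (F : (Fin m → ℝ) → (Fin m → ℝ))
    (Nw : Fin (m - 1) → ((Fin m → ℝ) → (Fin m → ℝ))) (α β : Fin (m - 1))
    (x : Fin m → ℝ) : ℝ :=
  ∑ k : Fin m, ∑ j : Fin m,
    if (k : ℕ) < (j : ℕ) then
      (pd m k (fun y => F y j) x - pd m j (fun y => F y k) x)
        * (Nw α x k * Nw β x j - Nw α x j * Nw β x k)
    else 0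

theorem sq_sub_le_of_le_add {a b c : ℝ} (ha : 0 ≤ a) (hb : 0 ≤ b) (h : a ≤ c + b) :
    a ^ 2 - 2 * a * b ≤ c ^ 2 := by
  rcases le_total b a with hba | hba
  · nlinarith
  · nlinarith [sq_nonneg c]

section Invariance

open Filter
open scoped RealInnerProductSpace Topology

variable {E : Type*} [NormedAddCommGroup E]

/-- `z` is a point of `Z` at minimal distance from `y`; thus `y - z` is a proximal normal
to `Z` at `z`. -/
def IsNearestPoint (Z : Set E) (y z : E) : Prop := z ∈ Z ∧ ∀ z' ∈ Z, ‖y - z‖ ≤ ‖y - z'‖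

theorem IsNearestPoint.infDist_eq {Z : Set E} {y z : E} (h : IsNearestPoint Z y z) :
    Metric.infDist y Z = ‖y - z‖ := by
  apply le_antisymm
  · rw [← dist_eq_norm]
    exact Metric.infDist_le_dist_of_mem h.1
  · exact (Metric.le_infDist ⟨z, h.1⟩).2 fun z' hz' => by
      rw [dist_eq_norm]; exact h.2 z' hz'

theorem exists_isNearestPoint [ProperSpace E] {U Z : Set E} (hU : IsOpen U) (hZU : Z ⊆ U)
    (hZ : closure Z ∩ U ⊆ Z) {z₀ : E} (hz₀ : z₀ ∈ Z) :
    ∃ ρ > 0, ∀ y, ‖y - z₀‖ ≤ ρ → ∃ z, IsNearestPoint Z y z ∧ ‖y - z‖ ≤ ‖y - z₀‖ := by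
  obtain ⟨δ, hδ, hball⟩ := Metric.nhds_basis_closedBall.mem_iff.1 (hU.mem_nhds (hZU hz₀))
  have hcl : IsClosed (Z ∩ Metric.closedBall z₀ δ) := by
    refine isClosed_of_closure_subset fun x hx => ?_
    have h2 : x ∈ Metric.closedBall z₀ δ :=
      Metric.isClosed_closedBall.closure_subset_iff.2 inter_subset_right hx
    exact ⟨hZ ⟨closure_mono inter_subset_left hx, hball h2⟩, h2⟩
  have hK : IsCompact (Z ∩ Metric.closedBall z₀ δ) :=
    (isCompact_closedBall z₀ δ).of_isClosed_subset hcl inter_subset_right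
  have hz₀K : z₀ ∈ Z ∩ Metric.closedBall z₀ δ := ⟨hz₀, Metric.mem_closedBall_self hδ.le⟩
  refine ⟨δ / 2, by positivity, fun y hy => ?_⟩
  obtain ⟨z, hz, hmin⟩ := hK.exists_isMinOn ⟨z₀, hz₀K⟩
    (f := fun z => ‖y - z‖) (by fun_prop)
  have hzz₀ : ‖y - z‖ ≤ ‖y - z₀‖ := hmin hz₀K
  refine ⟨z, ⟨hz.1, fun z' hz' => ?_⟩, hzz₀⟩
  by_cases hb : z' ∈ Metric.closedBall z₀ δ
  · exact hmin ⟨hz', hb⟩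
  · rw [Metric.mem_closedBall, dist_eq_norm, not_le] at hb
    have : ‖z' - z₀‖ ≤ ‖y - z'‖ + ‖y - z₀‖ := by
      rw [norm_sub_rev y z']
      simpa using norm_add_le (z' - y) (y - z₀)
    linarith

variable [InnerProductSpace ℝ E]

/-- A quantitative form of Nagumo's invariance theorem for approximate trajectories. -/
theorem infDist_sq_le_of_approx_tangent {Z : Set E} {γ γ' : ℝ → E} {T η L : ℝ} (hT : 0 ≤ T)
    (hL : 0 ≤ L) (hγ : ∀ t, HasDerivAt γ (γ' t) t) (h0 : γ 0 ∈ Z)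
    (hnear : ∀ t ∈ Icc 0 T, ∃ z, IsNearestPoint Z (γ t) z ∧
      ⟪γ' t, γ t - z⟫ ≤ (η + L * ‖γ t - z‖) * ‖γ t - z‖) :
    Metric.infDist (γ T) Z ^ 2 ≤ η ^ 2 * ((Real.exp ((2 * L + 1) * T) - 1) / (2 * L + 1)) := by
  classical
  have hγc : Continuous γ := continuous_iff_continuousAt.2 fun t => (hγ t).continuousAt
  choose! z hz hzin using hnear
  have key := le_gronwallBound_of_liminf_deriv_right_le (a := 0) (b := T) (δ := 0)
    (f := fun t => Metric.infDist (γ t) Z ^ 2) (f' := fun t => 2 * ⟪γ t - z t, γ' t⟫)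
    (K := 2 * L + 1) (ε := η ^ 2) ?_ ?_ ?_ ?_ T (right_mem_Icc.2 hT)
  · rw [gronwallBound_of_K_ne_0 (by positivity)] at key
    refine key.trans (le_of_eq ?_)
    simp only [sub_zero]
    ring
  · exact (((Metric.continuous_infDist_pt Z).comp hγc).pow 2).continuousOn
  · intro t ht r hr
    have hG : HasDerivAt (fun s => ‖γ s - z t‖ ^ 2) (2 * ⟪γ t - z t, γ' t⟫) t :=
      ((hγ t).sub_const (z t)).norm_sq
    have hs := (hasDerivAt_iff_tendsto_slope.1 hG).mono_left
      (nhdsWithin_mono t fun s (hs : t < s) => hs.ne')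
    refine Eventually.frequently ?_
    filter_upwards [hs.eventually_lt_const hr, self_mem_nhdsWithin] with s hs1 hs2
    refine lt_of_le_of_lt ?_ hs1
    have hpos : 0 < s - t := sub_pos.2 hs2
    rw [slope_def_field, div_eq_inv_mul]
    have hnt := hz t (Ico_subset_Icc_self ht)
    rw [hnt.infDist_eq]
    gcongr
    · exact Metric.infDist_nonneg
    · rw [← dist_eq_norm]
      exact Metric.infDist_le_dist_of_mem hnt.1
  · simp [Metric.infDist_zero_of_mem h0]
  · intro t ht
    have ht' := Ico_subset_Icc_self ht
    have h1 := hzin t ht'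
    rw [real_inner_comm] at h1
    rw [(hz t ht').infDist_eq]
    nlinarith [sq_nonneg (η - ‖γ t - z t‖)]

set_option maxHeartbeats 1000000 in
/-- If the fields `X` and `Y` are orthogonal to all proximal normals of `Z`, then their bracket
has nonpositive product with them. -/
theorem inner_bracket_nonpos [ProperSpace E] {U Z : Set E} (hU : IsOpen U) (hZU : Z ⊆ U)
    (hZ : closure Z ∩ U ⊆ Z) {X Y : E → E} (hX : ContDiffOn ℝ 1 X U) (hY : ContDiffOn ℝ 1 Y U)
    (htX : ∀ y z, IsNearestPoint Z y z → ⟪X z, y - z⟫ = 0)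
    (htY : ∀ y z, IsNearestPoint Z y z → ⟪Y z, y - z⟫ = 0)
    {y₀ z₀ : E} (h₀ : IsNearestPoint Z y₀ z₀) :
    ⟪y₀ - z₀, fderiv ℝ Y z₀ (X z₀) - fderiv ℝ X z₀ (Y z₀)⟫ ≤ 0 := by
  have hz₀ := h₀.1
  have hUz := hU.mem_nhds (hZU hz₀)
  obtain ⟨ρ, hρ, hnear⟩ := exists_isNearestPoint hU hZU hZ hz₀
  obtain ⟨LX, sX, hsX, hLX⟩ := (hX.contDiffAt hUz).exists_lipschitzOnWith
  obtain ⟨LY, sY, hsY, hLY⟩ := (hY.contDiffAt hUz).exists_lipschitzOnWith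
  have hdX : HasFDerivAt X (fderiv ℝ X z₀) z₀ :=
    ((hX.contDiffAt hUz).differentiableAt (by norm_num)).hasFDerivAt
  have hdY : HasFDerivAt Y (fderiv ℝ Y z₀) z₀ :=
    ((hY.contDiffAt hUz).differentiableAt (by norm_num)).hasFDerivAt
  set A := fderiv ℝ X z₀
  set B := fderiv ℝ Y z₀
  set p : ℝ → E := fun t => Real.sin t • X z₀ + (1 - Real.cos t) • Y z₀ with hp
  set r : ℝ → E := fun t =>
    A ((Real.sin t ^ 2 / 2) • X z₀ + (Real.sin t - t / 2 - Real.sin t * Real.cos t / 2) • Y z₀)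
    + B ((t / 2 - Real.sin t * Real.cos t / 2) • X z₀ + ((1 - Real.cos t) ^ 2 / 2) • Y z₀) with hr
  set p' : ℝ → E := fun t => Real.cos t • X z₀ + Real.sin t • Y z₀ with hp'
  have hpd : ∀ t, HasDerivAt p (p' t) t := by
    intro t
    have h1 := ((Real.hasDerivAt_sin t).smul_const (X z₀)).add
      (((Real.hasDerivAt_cos t).const_sub 1).smul_const (Y z₀))
    refine h1.congr_deriv ?_
    simp [hp']
  have hrd : ∀ t, HasDerivAt r (Real.cos t • A (p t) + Real.sin t • B (p t)) t := by
    intro t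
    have hs := Real.hasDerivAt_sin t
    have hc := Real.hasDerivAt_cos t
    have hsc : Real.sin t ^ 2 = 1 - Real.cos t ^ 2 := Real.sin_sq t
    have c1 : HasDerivAt (fun t => Real.sin t ^ 2 / 2) (Real.cos t * Real.sin t) t := by
      refine ((hs.pow 2).div_const 2).congr_deriv ?_
      push_cast; ring
    have c2 : HasDerivAt (fun t => Real.sin t - t / 2 - Real.sin t * Real.cos t / 2)
        (Real.cos t * (1 - Real.cos t)) t := by
      refine ((hs.sub ((hasDerivAt_id t).div_const 2)).sub
        ((hs.mul hc).div_const 2)).congr_deriv ?_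
      linear_combination (1 / 2) * hsc
    have c3 : HasDerivAt (fun t => t / 2 - Real.sin t * Real.cos t / 2)
        (Real.sin t * Real.sin t) t := by
      refine (((hasDerivAt_id t).div_const 2).sub
        ((hs.mul hc).div_const 2)).congr_deriv ?_
      linear_combination (-1 / 2) * hsc
    have c4 : HasDerivAt (fun t => (1 - Real.cos t) ^ 2 / 2)
        (Real.sin t * (1 - Real.cos t)) t := by
      refine (((hc.const_sub 1).pow 2).div_const 2).congr_deriv ?_
      push_cast; ring
    have h1 := A.hasFDerivAt.comp_hasDerivAt t
      ((c1.smul_const (X z₀)).add (c2.smul_const (Y z₀)))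
    have h2 := B.hasFDerivAt.comp_hasDerivAt t
      ((c3.smul_const (X z₀)).add (c4.smul_const (Y z₀)))
    refine (h1.add h2).congr_deriv ?_
    simp only [hp, map_add, map_smul, smul_add, smul_smul]
  have hpc : Continuous p := continuous_iff_continuousAt.2 fun t => (hpd t).continuousAt
  have hrc : Continuous r := continuous_iff_continuousAt.2 fun t => (hrd t).continuousAt
  have hT : (0 : ℝ) ≤ 2 * Real.pi := by positivity
  have hcpt : IsCompact (Icc 0 (2 * Real.pi)) := isCompact_Icc
  obtain ⟨Cp, hCp⟩ := hcpt.exists_bound_of_continuousOn hpc.continuousOn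
  obtain ⟨Cr, hCr⟩ := hcpt.exists_bound_of_continuousOn hrc.continuousOn
  have hCp0 : 0 ≤ Cp := (norm_nonneg _).trans (hCp 0 (left_mem_Icc.2 hT))
  have hCr0 : 0 ≤ Cr := (norm_nonneg _).trans (hCr 0 (left_mem_Icc.2 hT))
  set C := Cp + Cr with hC
  set L : ℝ := LX + LY with hL
  have hL0 : 0 ≤ L := by positivity
  set M := (Real.exp ((2 * L + 1) * (2 * Real.pi)) - 1) / (2 * L + 1) with hM
  have hM0 : 0 ≤ M := by
    have : 1 ≤ Real.exp ((2 * L + 1) * (2 * Real.pi)) := Real.one_le_exp (by positivity)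
    exact div_nonneg (by linarith) (by positivity)
  set W := B (X z₀) - A (Y z₀) with hW
  set D := 2 * C + (‖A‖ + ‖B‖) * Cr with hD
  have hD0 : 0 ≤ D := by positivity
  have main : ∀ η > 0, 2 * Real.pi * ⟪y₀ - z₀, W⟫ ≤ 2 * ‖y₀ - z₀‖ * Real.sqrt M * (D * η) := by
    intro η hη
    obtain ⟨δ, hδ, hδs⟩ := Metric.mem_nhds_iff.1
      (inter_mem (inter_mem hsX hsY) (inter_mem ((hdX.isLittleO).def hη) ((hdY.isLittleO).def hη)))
    have small : ∀ᶠ ε in 𝓝[>] (0 : ℝ), 2 * Real.pi * ⟪y₀ - z₀, W⟫ ≤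
        ε ^ 2 * (Real.pi ^ 2 * ‖W‖ ^ 2) + 2 * ‖y₀ - z₀‖ * Real.sqrt M * (D * η) := by
      have e1 : ∀ᶠ ε in 𝓝[>] (0 : ℝ), ε < min (min 1 η) (min (δ / (2 * C + 1)) (ρ / (C + 1))) :=
        (eventually_lt_nhds (by positivity)).filter_mono nhdsWithin_le_nhds
      filter_upwards [e1, self_mem_nhdsWithin] with ε hε (hε0 : 0 < ε)
      simp only [lt_min_iff] at hε
      obtain ⟨⟨hε1, hεη⟩, hεδ, hερ⟩ := hε
      rw [lt_div_iff₀ (by positivity)] at hεδ hερ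
      set γ : ℝ → E := fun t => z₀ + ε • p t + ε ^ 2 • r t with hγ
      set γ' : ℝ → E := fun t =>
        ε • p' t + ε ^ 2 • (Real.cos t • A (p t) + Real.sin t • B (p t)) with hγ'
      have hγd : ∀ t, HasDerivAt γ (γ' t) t := by
        intro t
        have := (((hpd t).const_smul ε).const_add z₀).add ((hrd t).const_smul (ε ^ 2))
        exact this
      have hγ0 : γ 0 = z₀ := by simp [hγ, hp, hr]
      have hγT : γ (2 * Real.pi) = z₀ + (ε ^ 2 * Real.pi) • W := by
        simp only [hγ, hp, hr, hW, Real.sin_two_pi, Real.cos_two_pi]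
        simp [smul_smul, sub_eq_add_neg, add_comm]
      have hγb : ∀ t ∈ Icc 0 (2 * Real.pi), ‖γ t - z₀‖ ≤ ε * C := by
        intro t ht
        have e : γ t - z₀ = ε • p t + ε ^ 2 • r t := by simp only [hγ]; abel
        rw [e]
        refine (norm_add_le _ _).trans ?_
        rw [norm_smul, norm_smul, Real.norm_of_nonneg hε0.le,
          Real.norm_of_nonneg (by positivity : 0 ≤ ε ^ 2)]
        have a1 := hCp t ht
        have a2 := hCr t ht
        have a3 : ε ^ 2 ≤ ε := by nlinarith
        calc ε * ‖p t‖ + ε ^ 2 * ‖r t‖ ≤ ε * Cp + ε * Cr := by gcongr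
          _ = ε * C := by rw [hC]; ring
      have lin : ∀ (G : E → E) (A' : E →L[ℝ] E) (t : ℝ), t ∈ Icc 0 (2 * Real.pi) →
          ‖G (γ t) - G z₀ - A' (γ t - z₀)‖ ≤ η * ‖γ t - z₀‖ →
          ‖G (γ t) - G z₀ - ε • A' (p t)‖ ≤ ε * (η * (C + ‖A'‖ * Cr)) := by
        intro G A' t ht hG
        have e : G (γ t) - G z₀ - ε • A' (p t)
            = (G (γ t) - G z₀ - A' (γ t - z₀)) + ε ^ 2 • A' (r t) := by
          have : γ t - z₀ = ε • p t + ε ^ 2 • r t := by simp only [hγ]; abel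
          rw [this, map_add A' (ε • p t), map_smul A' ε (p t), map_smul A' (ε ^ 2) (r t)]; abel
        rw [e]
        refine (norm_add_le _ _).trans ?_
        rw [norm_smul, Real.norm_of_nonneg (by positivity : 0 ≤ ε ^ 2)]
        have a2 : ‖A' (r t)‖ ≤ ‖A'‖ * Cr :=
          (A'.le_opNorm _).trans (by gcongr; exact hCr t ht)
        calc ‖G (γ t) - G z₀ - A' (γ t - z₀)‖ + ε ^ 2 * ‖A' (r t)‖
            ≤ η * (ε * C) + (ε * η) * (‖A'‖ * Cr) := by
              refine add_le_add (hG.trans ?_) ?_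
              · gcongr; exact hγb t ht
              · have : ε ^ 2 ≤ ε * η := by nlinarith
                gcongr
          _ = _ := by ring
      have hdist := infDist_sq_le_of_approx_tangent (Z := Z) hT hL0 (η := ε ^ 2 * (D * η)) hγd
        (by rw [hγ0]; exact hz₀) (by
          intro t ht
          have hb := hγb t ht
          obtain ⟨z, hz, hzd⟩ := hnear (γ t) (by linarith)
          refine ⟨z, hz, ?_⟩
          have m1 : γ t ∈ Metric.ball z₀ δ := by
            rw [Metric.mem_ball, dist_eq_norm]; nlinarith
          have m2 : z ∈ Metric.ball z₀ δ := by
            rw [Metric.mem_ball, dist_eq_norm]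
            have : ‖z - z₀‖ ≤ ‖γ t - z‖ + ‖γ t - z₀‖ := by
              rw [norm_sub_rev (γ t) z]
              simpa using norm_add_le (z - γ t) (γ t - z₀)
            nlinarith
          obtain ⟨⟨k1, k2⟩, k3, k4⟩ := hδs m1
          obtain ⟨⟨l1, l2⟩, -, -⟩ := hδs m2
          have q1 := hLX.norm_sub_le k1 l1
          have q2 := hLY.norm_sub_le k2 l2
          have q3 := lin X A t ht k3
          have q4 := lin Y B t ht k4
          have hc := Real.abs_cos_le_one t
          have hs := Real.abs_sin_le_one t
          have e : γ' t = -(ε • (Real.cos t • (X (γ t) - X z₀ - ε • A (p t))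
              + Real.sin t • (Y (γ t) - Y z₀ - ε • B (p t))))
              + ε • (Real.cos t • (X (γ t) - X z) + Real.sin t • (Y (γ t) - Y z))
              + (ε * Real.cos t) • X z + (ε * Real.sin t) • Y z := by
            simp only [hγ', hp']
            module
          have n1 : ‖-(ε • (Real.cos t • (X (γ t) - X z₀ - ε • A (p t))
              + Real.sin t • (Y (γ t) - Y z₀ - ε • B (p t))))‖ ≤ ε ^ 2 * (D * η) := by
            rw [norm_neg, norm_smul, Real.norm_of_nonneg hε0.le]
            have := norm_add_le (Real.cos t • (X (γ t) - X z₀ - ε • A (p t)))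
              (Real.sin t • (Y (γ t) - Y z₀ - ε • B (p t)))
            rw [norm_smul, norm_smul] at this
            calc _ ≤ ε * (1 * (ε * (η * (C + ‖A‖ * Cr))) + 1 * (ε * (η * (C + ‖B‖ * Cr)))) := by
                  gcongr
                  refine this.trans ?_
                  gcongr <;> assumption
              _ = _ := by rw [hD]; ring
          have n2 : ‖ε • (Real.cos t • (X (γ t) - X z) + Real.sin t • (Y (γ t) - Y z))‖
              ≤ L * ‖γ t - z‖ := by
            rw [norm_smul, Real.norm_of_nonneg hε0.le]
            have := norm_add_le (Real.cos t • (X (γ t) - X z)) (Real.sin t • (Y (γ t) - Y z))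
            rw [norm_smul, norm_smul] at this
            calc _ ≤ 1 * (1 * (LX * ‖γ t - z‖) + 1 * (LY * ‖γ t - z‖)) := by
                  gcongr
                  refine this.trans ?_
                  gcongr <;> assumption
              _ = _ := by rw [hL]; ring
          rw [e, inner_add_left, inner_add_left, inner_add_left, real_inner_smul_left (X z),
            real_inner_smul_left (Y z), htX _ _ hz, htY _ _ hz]
          have i1 := (real_inner_le_norm _ (γ t - z)).trans
            (mul_le_mul_of_nonneg_right n1 (norm_nonneg (γ t - z)))
          have i2 := (real_inner_le_norm _ (γ t - z)).trans
            (mul_le_mul_of_nonneg_right n2 (norm_nonneg (γ t - z)))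
          linarith)
      obtain ⟨z, hz, -⟩ := hnear (γ (2 * Real.pi)) (by
        linarith [hγb _ (right_mem_Icc.2 hT)])
      rw [hz.infDist_eq] at hdist
      have hd2 : ‖γ (2 * Real.pi) - z‖ ≤ Real.sqrt M * (ε ^ 2 * (D * η)) := by
        refine abs_le_of_sq_le_sq' ?_ (by positivity) |>.2
        rw [mul_pow, Real.sq_sqrt hM0]
        linarith
      have h1 := h₀.2 z hz.1
      have h2 : ‖y₀ - z‖ ≤ ‖y₀ - γ (2 * Real.pi)‖ + ‖γ (2 * Real.pi) - z‖ := by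
        simpa using norm_add_le (y₀ - γ (2 * Real.pi)) (γ (2 * Real.pi) - z)
      have e : y₀ - γ (2 * Real.pi) = (y₀ - z₀) - (ε ^ 2 * Real.pi) • W := by
        rw [hγT]; abel
      have h3 : ‖y₀ - γ (2 * Real.pi)‖ ^ 2 = ‖y₀ - z₀‖ ^ 2
          - 2 * (ε ^ 2 * Real.pi * ⟪y₀ - z₀, W⟫) + (ε ^ 2 * Real.pi) ^ 2 * ‖W‖ ^ 2 := by
        rw [e, norm_sub_sq_real, real_inner_smul_right, norm_smul, mul_pow,
          Real.norm_of_nonneg (by positivity : 0 ≤ ε ^ 2 * Real.pi)]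
      have h5 := sq_sub_le_of_le_add (norm_nonneg (y₀ - z₀))
        (by positivity : 0 ≤ Real.sqrt M * (ε ^ 2 * (D * η)))
        (h1.trans (h2.trans (add_le_add_right hd2 _)))
      rw [h3] at h5
      have h6 : 0 < ε ^ 2 := by positivity
      refine le_of_mul_le_mul_left ?_ h6
      linarith
    have lim : Tendsto (fun ε : ℝ => ε ^ 2 * (Real.pi ^ 2 * ‖W‖ ^ 2)
        + 2 * ‖y₀ - z₀‖ * Real.sqrt M * (D * η)) (𝓝[>] 0)
        (𝓝 ((0 : ℝ) ^ 2 * (Real.pi ^ 2 * ‖W‖ ^ 2) + 2 * ‖y₀ - z₀‖ * Real.sqrt M * (D * η))) :=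
      (Continuous.tendsto (by fun_prop) 0).mono_left nhdsWithin_le_nhds
    have := ge_of_tendsto lim small
    simpa using this
  have lim : Tendsto (fun η : ℝ => 2 * ‖y₀ - z₀‖ * Real.sqrt M * (D * η)) (𝓝[>] 0)
      (𝓝 (2 * ‖y₀ - z₀‖ * Real.sqrt M * (D * 0))) :=
    (Continuous.tendsto (by fun_prop) 0).mono_left nhdsWithin_le_nhds
  have hle := ge_of_tendsto lim (eventually_mem_nhdsWithin.mono fun η hη => main η hη)
  rw [mul_zero, mul_zero] at hle
  have hpi := Real.pi_pos
  by_contra hneg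
  nlinarith [mul_pos hpi (not_le.1 hneg)]

/-- Propagation principle of Bony type: `Z` is open if all its proximal normals are multiples of a
field `P` that is orthogonal to `X` and `Y` but not to their bracket. -/
theorem isOpen_of_proximal_normals [ProperSpace E] {U Z : Set E} (hU : IsOpen U) (hZU : Z ⊆ U)
    (hZ : closure Z ∩ U ⊆ Z) {X Y P : E → E} (hX : ContDiffOn ℝ 1 X U) (hY : ContDiffOn ℝ 1 Y U)
    (hP : ∀ y z, IsNearestPoint Z y z → ∃ c : ℝ, y - z = c • P z)
    (hXP : ∀ z ∈ Z, ⟪X z, P z⟫ = 0) (hYP : ∀ z ∈ Z, ⟪Y z, P z⟫ = 0)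
    (hXY : ∀ z ∈ Z, ⟪P z, fderiv ℝ Y z (X z) - fderiv ℝ X z (Y z)⟫ ≠ 0) : IsOpen Z := by
  have htX : ∀ y z, IsNearestPoint Z y z → ⟪X z, y - z⟫ = 0 := by
    intro y z h
    obtain ⟨c, hc⟩ := hP y z h
    rw [hc, real_inner_smul_right, hXP z h.1, mul_zero]
  have htY : ∀ y z, IsNearestPoint Z y z → ⟪Y z, y - z⟫ = 0 := by
    intro y z h
    obtain ⟨c, hc⟩ := hP y z h
    rw [hc, real_inner_smul_right, hYP z h.1, mul_zero]
  rw [Metric.isOpen_iff]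
  intro z₀ hz₀
  obtain ⟨ρ, hρ, hnear⟩ := exists_isNearestPoint hU hZU hZ hz₀
  refine ⟨ρ, hρ, fun y hy => ?_⟩
  rw [Metric.mem_ball, dist_eq_norm] at hy
  obtain ⟨z, hz, -⟩ := hnear y hy.le
  have h1 := inner_bracket_nonpos hU hZU hZ hX hY htX htY hz
  have h2 := inner_bracket_nonpos hU hZU hZ hY hX htY htX hz
  rw [← neg_sub (fderiv ℝ Y z (X z)), inner_neg_right] at h2
  have h3 := le_antisymm h1 (by linarith)
  obtain ⟨c, hc⟩ := hP y z hz
  rw [hc, real_inner_smul_left] at h3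
  rcases mul_eq_zero.1 h3 with h | h
  · rw [h, zero_smul, sub_eq_zero] at hc
    rw [hc]; exact hz.1
  · exact absurd h (hXY z hz.1)

end Invariance

section Curvature

open Filter Topology

variable {m : ℕ}

theorem ee_val (i : Fin m) : ee m i = Pi.single i 1 := by
  ext j
  simp [ee, Pi.single_apply, Fin.ext_iff]

theorem apply_eq_sum_pd (L : (Fin m → ℝ) →L[ℝ] ℝ) (ξ : Fin m → ℝ) :
    L ξ = ∑ j : Fin m, L (ee m j) * ξ j := by
  conv_lhs => rw [pi_eq_sum_univ' ξ, map_sum]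
  refine sum_congr rfl fun j _ => ?_
  rw [map_smul, smul_eq_mul, mul_comm, ee_val]

/-- The Jacobian matrix of `p ↦ p / |p|`. -/
def normalJac (p : Fin m → ℝ) (i j : Fin m) : ℝ :=
  (if i = j then 1 else 0) / √(∑ k, p k ^ 2) - p i * p j / √(∑ k, p k ^ 2) ^ 3

theorem sum_sq_pos {p : Fin m → ℝ} (hp : p ≠ 0) : 0 < ∑ k, p k ^ 2 := by
  obtain ⟨i, hi⟩ := Function.ne_iff.1 hp
  exact sum_pos' (fun k _ => sq_nonneg _) ⟨i, mem_univ i, by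
    have : p i ≠ 0 := hi
    positivity⟩

theorem hasFDerivAt_normal {p : Fin m → ℝ} (hp : p ≠ 0) (i : Fin m) :
    ∃ L : (Fin m → ℝ) →L[ℝ] ℝ, HasFDerivAt (fun p : Fin m → ℝ => p i / √(∑ k, p k ^ 2)) L p ∧
      ∀ ξ, L ξ = ∑ j, normalJac p i j * ξ j := by
  have hS := sum_sq_pos hp
  have hR : 0 < √(∑ k, p k ^ 2) := Real.sqrt_pos.2 hS
  have hsum : HasFDerivAt (fun p : Fin m → ℝ => ∑ k, p k ^ 2)
      (∑ k, (2 * p k) • (ContinuousLinearMap.proj k : (Fin m → ℝ) →L[ℝ] ℝ)) p := by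
    refine HasFDerivAt.fun_sum fun k _ => ?_
    simpa using (hasFDerivAt_apply (𝕜 := ℝ) k p).pow 2
  have h := (hasFDerivAt_apply (𝕜 := ℝ) i p).mul
    ((hasDerivAt_inv hR.ne').comp_hasFDerivAt p (hsum.sqrt hS.ne'))
  refine ⟨_, h.congr_of_eventuallyEq (Eventually.of_forall fun q => by
    simp [div_eq_mul_inv]), fun ξ => ?_⟩
  simp only [normalJac, sub_mul, sum_sub_distrib]
  simp only [_root_.add_apply, _root_.smul_apply,
    _root_.sum_apply, ContinuousLinearMap.proj_apply, smul_eq_mul, Function.comp]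
  have e1 : ∑ j, (if i = j then (1 : ℝ) else 0) / √(∑ k, p k ^ 2) * ξ j
      = ξ i / √(∑ k, p k ^ 2) := by
    rw [Finset.sum_eq_single i]
    · simp; ring
    · intro j _ hj; simp [hj.symm]
    · simp
  have e2 : ∑ j, p i * p j / √(∑ k, p k ^ 2) ^ 3 * ξ j
      = p i / √(∑ k, p k ^ 2) ^ 3 * ∑ j, p j * ξ j := by
    rw [mul_sum]; exact sum_congr rfl fun j _ => by ring
  have e3 : ∑ j, 2 * p j * ξ j = 2 * ∑ j, p j * ξ j := by
    rw [mul_sum]; exact sum_congr rfl fun j _ => by ring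
  rw [e1, e2, e3]
  field_simp
  ring

theorem contDiffAt_normalJac {p : Fin m → ℝ} (hp : p ≠ 0) :
    ContDiffAt ℝ 1 (normalJac : (Fin m → ℝ) → Fin m → Fin m → ℝ) p := by
  have hS := sum_sq_pos hp
  have hR : √(∑ k, p k ^ 2) ≠ 0 := (Real.sqrt_pos.2 hS).ne'
  have hs : ContDiffAt ℝ 1 (fun p : Fin m → ℝ => √(∑ k, p k ^ 2)) p := by
    refine ContDiffAt.sqrt (ContDiffAt.sum fun k _ => ?_) hS.ne'
    exact (contDiff_apply ℝ ℝ k).contDiffAt.pow 2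
  refine contDiffAt_pi.2 fun i => contDiffAt_pi.2 fun j => ?_
  exact (contDiffAt_const.div hs hR).sub
    (((contDiff_apply ℝ ℝ i).contDiffAt.mul (contDiff_apply ℝ ℝ j).contDiffAt).div (hs.pow 3) (pow_ne_zero 3 hR))

theorem normalJac_eq_sum {p : Fin m → ℝ} (hp : p ≠ 0) (i j : Fin m) :
    normalJac p i j = √(∑ k, p k ^ 2) * ∑ l, normalJac p l i * normalJac p l j := by
  have hS := sum_sq_pos hp
  have hR : 0 < √(∑ k, p k ^ 2) := Real.sqrt_pos.2 hS
  have hR2 : √(∑ k, p k ^ 2) ^ 2 = ∑ k, p k ^ 2 := Real.sq_sqrt hS.le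
  simp only [normalJac]
  generalize √(∑ k, p k ^ 2) = R at *
  have e : ∀ l, ((if l = i then (1 : ℝ) else 0) / R - p l * p i / R ^ 3) *
      ((if l = j then (1 : ℝ) else 0) / R - p l * p j / R ^ 3) =
      (if l = i then (if i = j then 1 else 0) / R ^ 2 else 0)
        - (if l = i then p i * p j / R ^ 4 else 0) - (if l = j then p i * p j / R ^ 4 else 0)
        + p l ^ 2 * (p i * p j / R ^ 6) := by
    intro l
    by_cases h1 : l = i
    · subst h1
      by_cases h2 : l = j
      · subst h2; simp; field_simp; ring
      · simp [h2]; field_simp; ring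
    · by_cases h2 : l = j
      · subst h2; simp [h1]; field_simp; ring
      · simp [h1, h2]; field_simp
  simp only [e, sum_add_distrib, sum_sub_distrib, ← sum_mul, sum_ite_eq', Finset.mem_univ, if_true]
  rw [← hR2]
  field_simp
  ring

theorem normalJac_trace_nonneg {p : Fin m → ℝ} (hp : p ≠ 0) {M : Fin m → Fin m → ℝ}
    (hM : ∀ ξ : Fin m → ℝ, 0 ≤ ∑ i, ∑ j, M i j * ξ i * ξ j) :
    0 ≤ ∑ i, ∑ j, normalJac p i j * M i j := by
  have e : ∑ i, ∑ j, normalJac p i j * M i j = √(∑ k, p k ^ 2) *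
      ∑ l, ∑ i, ∑ j, M i j * normalJac p l i * normalJac p l j := by
    rw [mul_sum]
    simp only [mul_sum]
    rw [sum_comm]
    rw [Finset.sum_comm (s := (univ : Finset (Fin m))) (t := univ)]
    conv_rhs => rw [sum_comm]
    refine sum_congr rfl fun i _ => ?_
    conv_rhs => rw [sum_comm]
    refine sum_congr rfl fun j _ => ?_
    rw [normalJac_eq_sum hp, mul_sum, sum_mul]
    exact sum_congr rfl fun l _ => by ring
  rw [e]
  exact mul_nonneg (Real.sqrt_nonneg _) (sum_nonneg fun l _ => hM _)

theorem normalJac_quadratic {p : Fin m → ℝ} (hp : p ≠ 0) (q : Fin m → ℝ) :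
    ∑ i, ∑ j, normalJac p i j * (q i * q j) = (√(∑ k, p k ^ 2))⁻¹ *
      ∑ i, (q i - (∑ k, p k * q k) / (∑ k, p k ^ 2) * p i) ^ 2 := by
  have hS := sum_sq_pos hp
  have hR : 0 < √(∑ k, p k ^ 2) := Real.sqrt_pos.2 hS
  have hR2 : √(∑ k, p k ^ 2) ^ 2 = ∑ k, p k ^ 2 := Real.sq_sqrt hS.le
  have e1 : ∀ c : ℝ, ∑ i, (q i - c * p i) ^ 2 =
      ∑ i, q i ^ 2 - 2 * c * (∑ k, p k * q k) + c ^ 2 * ∑ k, p k ^ 2 := by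
    intro c
    rw [mul_sum, mul_sum, ← sum_sub_distrib, ← sum_add_distrib]
    exact sum_congr rfl fun i _ => by ring
  have e2 : ∑ i, ∑ j, normalJac p i j * (q i * q j) = (∑ i, q i ^ 2) / √(∑ k, p k ^ 2)
      - (∑ k, p k * q k) ^ 2 / √(∑ k, p k ^ 2) ^ 3 := by
    simp only [normalJac, sub_mul, sum_sub_distrib]
    congr 1
    · rw [sum_div]
      refine sum_congr rfl fun i _ => ?_
      rw [Finset.sum_eq_single i]
      · simp; ring
      · intro j _ hj; simp [hj.symm]
      · simp
    · rw [sq, sum_mul_sum, sum_div]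
      refine sum_congr rfl fun i _ => ?_
      rw [sum_div]
      exact sum_congr rfl fun i _ => by ring
  rw [e1, e2]
  generalize √(∑ k, p k ^ 2) = R at hR hR2 ⊢
  rw [← hR2]
  field_simp
  ring

theorem Hmc_eq {F : (Fin m → ℝ) → (Fin m → ℝ)} {u : (Fin m → ℝ) → ℝ} {x : Fin m → ℝ}
    (h0 : gradF m F u x ≠ 0) (hd : ∀ j, DifferentiableAt ℝ (fun y => gradF m F u y j) x) :
    Hmc m F u x = ∑ i : Fin m, ∑ j : Fin m,
      normalJac (gradF m F u x) i j * pd m i (fun y => gradF m F u y j) x := by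
  refine sum_congr rfl fun i _ => ?_
  obtain ⟨L, hL, hLξ⟩ := hasFDerivAt_normal h0 i
  have hP : HasFDerivAt (gradF m F u)
      (ContinuousLinearMap.pi fun j => fderiv ℝ (fun y => gradF m F u y j) x) x :=
    hasFDerivAt_pi.2 fun j => (hd j).hasFDerivAt
  have h := hL.comp x hP
  have h' : HasFDerivAt (fun y => legN m F u y i) _ x := h
  rw [pd, h'.fderiv, ContinuousLinearMap.comp_apply, hLξ]
  rfl

theorem second_derivative_test {g g' : ℝ → ℝ} {g'' : ℝ}
    (hg : ∀ᶠ t in 𝓝 0, HasDerivAt g (g' t) t) (hg' : HasDerivAt g' g'' 0)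
    (hmin : IsLocalMin g 0) : g' 0 = 0 ∧ 0 ≤ g'' := by
  have h0 : g' 0 = 0 := hmin.hasDerivAt_eq_zero hg.self_of_nhds
  refine ⟨h0, ?_⟩
  by_contra hneg
  have hderiv : deriv g =ᶠ[𝓝 0] g' := hg.mono fun t ht => ht.deriv
  have hdd : deriv (deriv g) 0 = g'' := by rw [hderiv.deriv_eq, hg'.deriv]
  have hmax : IsLocalMax g 0 := isLocalMax_of_deriv_deriv_neg (by rw [hdd]; exact not_le.1 hneg)
    (by rw [hg.self_of_nhds.deriv, h0]) hg.self_of_nhds.continuousAt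
  have hconst : g =ᶠ[𝓝 0] fun _ => g 0 := by
    filter_upwards [hmin, hmax] with t h1 h2 using le_antisymm h2 h1
  have hz : deriv g =ᶠ[𝓝 0] fun _ => 0 := by
    filter_upwards [hconst.eventuallyEq_nhds] with t ht
    rw [ht.deriv_eq, deriv_const]
  rw [hz.deriv_eq, deriv_const] at hdd
  exact hneg hdd.le

/-- First and second order conditions at a local minimum of the difference of `f` and the
barrier `ε (s + k s²)`, where `s z = c - |z - y|²`. -/
theorem barrier_test {f : (Fin m → ℝ) → ℝ} {G : Fin m → (Fin m → ℝ) → ℝ} {x y : Fin m → ℝ}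
    {ε k c : ℝ} (hf : ∀ᶠ z in 𝓝 x, DifferentiableAt ℝ f z ∧ ∀ j : Fin m, G j z = pd m j f z)
    (hG : ∀ j, DifferentiableAt ℝ (G j) x)
    (hmin : IsLocalMin (fun z => f z - ε * ((c - ∑ i, (z i - y i) ^ 2)
      + k * (c - ∑ i, (z i - y i) ^ 2) ^ 2)) x) :
    (∀ j, G j x = -2 * ε * (1 + 2 * k * (c - ∑ i, (x i - y i) ^ 2)) * (x j - y j)) ∧
    ∀ ξ : Fin m → ℝ, ε * (-2 * (1 + 2 * k * (c - ∑ i, (x i - y i) ^ 2)) * ∑ i, ξ i ^ 2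
      + 8 * k * (∑ i, (x i - y i) * ξ i) ^ 2) ≤
      ∑ i : Fin m, ∑ j : Fin m, pd m i (G j) x * ξ i * ξ j := by
  have key : ∀ ξ : Fin m → ℝ, ∑ j, G j x * ξ j = -2 * ε *
      (1 + 2 * k * (c - ∑ i, (x i - y i) ^ 2)) * ∑ i, (x i - y i) * ξ i ∧
      ε * (-2 * (1 + 2 * k * (c - ∑ i, (x i - y i) ^ 2)) * ∑ i, ξ i ^ 2
      + 8 * k * (∑ i, (x i - y i) * ξ i) ^ 2) ≤
      ∑ i : Fin m, ∑ j : Fin m, pd m i (G j) x * ξ i * ξ j := by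
    intro ξ
    set b := ∑ i, (x i - y i) * ξ i with hb
    set q := ∑ i, ξ i ^ 2 with hq
    set s := c - ∑ i, (x i - y i) ^ 2 with hs
    have hline : ∀ t, HasDerivAt (fun t : ℝ => x + t • ξ) ξ t := fun t => by
      simpa using ((hasDerivAt_id t).smul_const ξ).const_add x
    have hx0 : x + (0 : ℝ) • ξ = x := by simp
    have hcont : Tendsto (fun t : ℝ => x + t • ξ) (𝓝 0) (𝓝 x) := by
      have := (hline 0).continuousAt
      rwa [ContinuousAt, hx0] at this
    have hsσ : ∀ t : ℝ, c - ∑ i, ((x + t • ξ) i - y i) ^ 2 = s - 2 * b * t - q * t ^ 2 := by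
      intro t
      have : ∑ i, ((x + t • ξ) i - y i) ^ 2 =
          ∑ i, (x i - y i) ^ 2 + 2 * t * b + t ^ 2 * q := by
        rw [hb, hq, mul_sum, mul_sum, ← sum_add_distrib, ← sum_add_distrib]
        refine sum_congr rfl fun i _ => ?_
        simp only [Pi.add_apply, Pi.smul_apply, smul_eq_mul]
        ring
      rw [this, hs]; ring
    have hσ : ∀ t, HasDerivAt (fun t : ℝ => s - 2 * b * t - q * t ^ 2) (-2 * b - 2 * q * t) t := by
      intro t
      refine ((((hasDerivAt_id t).const_mul (2 * b)).const_sub s).sub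
        (((hasDerivAt_id t).pow 2).const_mul q)).congr_deriv ?_
      simp; ring
    have hσ' : HasDerivAt (fun t : ℝ => -2 * b - 2 * q * t) (-2 * q) 0 := by
      refine (((hasDerivAt_id (0 : ℝ)).const_mul (2 * q)).const_sub (-2 * b)).congr_deriv ?_
      simp
    have hφ : ∀ t, HasDerivAt (fun t : ℝ => ε * ((s - 2 * b * t - q * t ^ 2)
        + k * (s - 2 * b * t - q * t ^ 2) ^ 2))
        (ε * ((1 + 2 * k * (s - 2 * b * t - q * t ^ 2)) * (-2 * b - 2 * q * t))) t := by
      intro t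
      refine (((hσ t).add (((hσ t).pow 2).const_mul k)).const_mul ε).congr_deriv ?_
      push_cast; ring
    have hφ' : HasDerivAt (fun t : ℝ =>
        ε * ((1 + 2 * k * (s - 2 * b * t - q * t ^ 2)) * (-2 * b - 2 * q * t)))
        (ε * (-2 * (1 + 2 * k * s) * q + 8 * k * b ^ 2)) 0 := by
      refine (((((hσ 0).const_mul (2 * k)).const_add 1).mul hσ').const_mul ε).congr_deriv ?_
      ring
    have hgrad : ∀ᶠ t in 𝓝 (0 : ℝ), HasDerivAt (fun t : ℝ => f (x + t • ξ))
        (∑ j, G j (x + t • ξ) * ξ j) t := by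
      filter_upwards [hcont.eventually hf] with t ht
      have := ht.1.hasFDerivAt.comp_hasDerivAt t (hline t)
      rw [apply_eq_sum_pd] at this
      refine this.congr_deriv (sum_congr rfl fun j _ => ?_)
      rw [ht.2 j]; rfl
    have hgrad' : HasDerivAt (fun t : ℝ => ∑ j, G j (x + t • ξ) * ξ j)
        (∑ i : Fin m, ∑ j : Fin m, pd m i (G j) x * ξ i * ξ j) 0 := by
      rw [sum_comm]
      refine HasDerivAt.fun_sum fun j _ => ?_
      have hGj : HasFDerivAt (G j) (fderiv ℝ (G j) x) (x + (0 : ℝ) • ξ) := by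
        rw [hx0]; exact (hG j).hasFDerivAt
      have := (hGj.comp_hasDerivAt (0 : ℝ) (hline 0)).mul_const (ξ j)
      rw [apply_eq_sum_pd, sum_mul] at this
      exact this
    have hmin' : IsLocalMin (fun t : ℝ => f (x + t • ξ) - ε * ((s - 2 * b * t - q * t ^ 2)
        + k * (s - 2 * b * t - q * t ^ 2) ^ 2)) 0 := by
      have h := hcont.eventually hmin
      filter_upwards [h] with t ht
      simp only [hsσ] at ht
      simpa [hx0, hs] using ht
    obtain ⟨h1, h2⟩ := second_derivative_test
      (hgrad.mono fun t ht => ht.sub (hφ t)) (hgrad'.sub hφ') hmin'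
    simp only [hx0] at h1
    refine ⟨?_, by linarith⟩
    linear_combination h1
  refine ⟨fun j => ?_, fun ξ => (key ξ).2⟩
  have h := (key (Pi.single j 1)).1
  simpa [Pi.single_apply] using h

theorem contDiffOn_gradF {U : Set (Fin m → ℝ)} (hU : IsOpen U) {F : (Fin m → ℝ) → (Fin m → ℝ)}
    (hF : ContDiffOn ℝ 1 F U) {u : (Fin m → ℝ) → ℝ} (hu : ContDiffOn ℝ 2 u U) :
    ContDiffOn ℝ 1 (gradF m F u) U := by
  refine contDiffOn_pi.2 fun j => ?_
  exact ((hu.fderiv_of_isOpen hU (by norm_num)).clm_apply contDiffOn_const).add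
    (contDiffOn_pi.1 hF j)

theorem sum_mul_sub_rank_one (a M : Fin m → Fin m → ℝ) (d : Fin m → ℝ) (ε s t : ℝ) :
    ∑ i, ∑ j, a i j * (M i j - ε * (s * (if i = j then 1 else 0) + t * (d i * d j))) =
      ∑ i, ∑ j, a i j * M i j
        - ε * (s * (∑ i, a i i) + t * ∑ i, ∑ j, a i j * (d i * d j)) := by
  have e1 : ∑ i, a i i = ∑ i, ∑ j, a i j * (if i = j then 1 else 0) :=
    sum_congr rfl fun i _ => by simp
  rw [e1, mul_sum, mul_sum, ← sum_add_distrib, mul_sum, ← sum_sub_distrib]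
  refine sum_congr rfl fun i _ => ?_
  rw [mul_sum, mul_sum, ← sum_add_distrib, mul_sum, ← sum_sub_distrib]
  exact sum_congr rfl fun j _ => by ring

theorem sum_sub_rank_one_mul (M : Fin m → Fin m → ℝ) (d ξ : Fin m → ℝ) (ε s t : ℝ) :
    ∑ i, ∑ j, (M i j - ε * (s * (if i = j then 1 else 0) + t * (d i * d j))) * ξ i * ξ j =
      ∑ i, ∑ j, M i j * ξ i * ξ j - ε * (s * (∑ i, ξ i ^ 2) + t * (∑ i, d i * ξ i) ^ 2) := by
  have h := sum_mul_sub_rank_one (fun i j => ξ i * ξ j) M d ε s t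
  have e1 : ∑ i, ∑ j, ξ i * ξ j * (d i * d j) = (∑ i, d i * ξ i) ^ 2 := by
    rw [sq, sum_mul_sum]
    exact sum_congr rfl fun i _ => sum_congr rfl fun j _ => by ring
  simp only [e1, ← sq] at h
  convert h using 1
  · exact sum_congr rfl fun i _ => sum_congr rfl fun j _ => by ring
  · congr 1
    exact sum_congr rfl fun i _ => sum_congr rfl fun j _ => by ring

set_option maxHeartbeats 1000000 in
/-- Proximal normals of the coincidence set of a touching pair are parallel to `∇u + F`. -/
theorem proximal_normal_parallel {U : Set (Fin m → ℝ)} (hU : IsOpen U)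
    {F : (Fin m → ℝ) → (Fin m → ℝ)} (hF : ContDiffOn ℝ 1 F U)
    {u v : (Fin m → ℝ) → ℝ} (hu : ContDiffOn ℝ 2 u U) (hv : ContDiffOn ℝ 2 v U)
    (hns_u : ∀ x ∈ U, gradF m F u x ≠ 0) (hns_v : ∀ x ∈ U, gradF m F v x ≠ 0)
    (hH : ∀ x ∈ U, Hmc m F u x ≤ Hmc m F v x) (huv : ∀ x ∈ U, v x ≤ u x)
    {x₀ y : Fin m → ℝ} (hx₀ : x₀ ∈ U) (htouch : u x₀ = v x₀)
    (hy : ∀ z ∈ U, u z = v z → ∑ i, (y i - x₀ i) ^ 2 ≤ ∑ i, (y i - z i) ^ 2) :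
    gradF m F u x₀ = gradF m F v x₀ ∧ ∃ c : ℝ, y - x₀ = c • gradF m F u x₀ := by
  set Pu := gradF m F u with hPu
  set Pv := gradF m F v with hPv
  have hCu : ContDiffOn ℝ 1 Pu U := contDiffOn_gradF hU hF hu
  have hCv : ContDiffOn ℝ 1 Pv U := contDiffOn_gradF hU hF hv
  have hdu : ∀ x ∈ U, ∀ j, DifferentiableAt ℝ (fun z => Pu z j) x := fun x hx j =>
    differentiableAt_pi.1 ((hCu.contDiffAt (hU.mem_nhds hx)).differentiableAt (by norm_num)) j
  have hdv : ∀ x ∈ U, ∀ j, DifferentiableAt ℝ (fun z => Pv z j) x := fun x hx j =>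
    differentiableAt_pi.1 ((hCv.contDiffAt (hU.mem_nhds hx)).differentiableAt (by norm_num)) j
  have hwd : ∀ x ∈ U, DifferentiableAt ℝ (fun z => u z - v z) x ∧
      ∀ j : Fin m, Pu x j - Pv x j = pd m j (fun z => u z - v z) x := by
    intro x hx
    have h1 := (hu.contDiffAt (hU.mem_nhds hx)).differentiableAt (by norm_num)
    have h2 := (hv.contDiffAt (hU.mem_nhds hx)).differentiableAt (by norm_num)
    refine ⟨h1.sub h2, fun j => ?_⟩
    rw [pd, fderiv_fun_sub h1 h2]
    simp [hPu, hPv, gradF, pd]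
  have hP0 : Pu x₀ = Pv x₀ := by
    have hmin : IsLocalMin (fun z => u z - v z) x₀ := by
      filter_upwards [hU.mem_nhds hx₀] with z hz
      rw [htouch, sub_self]
      exact sub_nonneg.2 (huv z hz)
    ext j
    have := (hwd x₀ hx₀).2 j
    rw [pd, hmin.fderiv_eq_zero] at this
    simpa [sub_eq_zero] using this
  refine ⟨hP0, ?_⟩
  set q : Fin m → ℝ := y - x₀ with hq
  by_contra hpar
  set y' : Fin m → ℝ := fun i => x₀ i + q i / 2 with hy'
  set c := ∑ i, (x₀ i - y' i) ^ 2 with hc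
  set s : (Fin m → ℝ) → ℝ := fun z => c - ∑ i, (z i - y' i) ^ 2 with hs
  have hsc : Continuous s := by fun_prop
  have hs0 : s x₀ = 0 := by simp [hs, hc]
  have hsZ : ∀ z ∈ U, u z = v z → z ≠ x₀ → s z < 0 := by
    intro z hz huz hne
    have h1 := hy z hz huz
    have h2 : 0 < ∑ i, (z - x₀) i ^ 2 := sum_sq_pos (sub_ne_zero.2 hne)
    have e1 : ∑ i, (y i - z i) ^ 2 = ∑ i, (y i - x₀ i) ^ 2
        + (2 * ∑ i, (z i - y' i) ^ 2 - 2 * c - ∑ i, (z - x₀) i ^ 2) := by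
      rw [hc, mul_sum, mul_sum, ← sum_sub_distrib, ← sum_sub_distrib, ← sum_add_distrib]
      refine sum_congr rfl fun i _ => ?_
      simp only [hy', hq, Pi.sub_apply]
      ring
    simp only [hs]
    linarith
  set Q : (Fin m → ℝ) → ℝ := fun x =>
    ∑ i, ∑ j, normalJac (Pu x) i j * ((x i - y' i) * (x j - y' j)) with hQ
  have hQ0 : 0 < Q x₀ := by
    have e : Q x₀ = (∑ i, ∑ j, normalJac (Pu x₀) i j * (q i * q j)) / 4 := by
      simp only [hQ, sum_div]
      refine sum_congr rfl fun i _ => sum_congr rfl fun j _ => ?_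
      simp only [hy']
      ring
    rw [e, normalJac_quadratic (hns_u x₀ hx₀)]
    have hR : 0 < √(∑ k, Pu x₀ k ^ 2) := Real.sqrt_pos.2 (sum_sq_pos (hns_u x₀ hx₀))
    have : 0 < ∑ i, (q - ((∑ k, Pu x₀ k * q k) / (∑ k, Pu x₀ k ^ 2)) • Pu x₀) i ^ 2 :=
      sum_sq_pos fun h => hpar ⟨_, sub_eq_zero.1 h⟩
    simp only [Pi.sub_apply, Pi.smul_apply, smul_eq_mul] at this
    positivity
  set κ := Q x₀ with hκ
  have hPuc : ContinuousAt Pu x₀ := (hCu.contDiffAt (hU.mem_nhds hx₀)).continuousAt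
  have hPvc : ContinuousAt Pv x₀ := (hCv.contDiffAt (hU.mem_nhds hx₀)).continuousAt
  have hJ : ContinuousAt (fun x => normalJac (Pu x)) x₀ :=
    ContinuousAt.comp (f := Pu) (contDiffAt_normalJac (hns_u x₀ hx₀)).continuousAt hPuc
  have hJij : ∀ i j, ContinuousAt (fun x => normalJac (Pu x) i j) x₀ := fun i j =>
    continuousAt_pi.1 (continuousAt_pi.1 hJ i) j
  have hQc : ContinuousAt Q x₀ := by
    refine tendsto_finsetSum _ fun i _ => tendsto_finsetSum _ fun j _ => ?_
    exact (hJij i j).mul (Continuous.continuousAt (by fun_prop))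
  have htrc : ContinuousAt (fun x => ∑ i, normalJac (Pu x) i i) x₀ :=
    tendsto_finsetSum _ fun i _ => hJij i i
  have hTc : ContinuousAt
      (fun x => ∑ i : Fin m, ∑ j, |pd m i (fun z => Pv z j) x|) x₀ := by
    refine tendsto_finsetSum _ fun i _ => tendsto_finsetSum _ fun j _ => ?_
    have h1 : ContDiffAt ℝ 1 (fun z => Pv z j) x₀ :=
      contDiffAt_pi.1 (hCv.contDiffAt (hU.mem_nhds hx₀)) j
    exact ((h1.continuousAt_fderiv (by norm_num)).clm_apply continuousAt_const).abs
  have hDc : ContinuousAt (fun x : Fin m → ℝ => ‖x - y'‖) x₀ :=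
    Continuous.continuousAt (by fun_prop)
  obtain ⟨L, sL, hsL, hL⟩ := (contDiffAt_normalJac (hns_u x₀ hx₀)).exists_lipschitzOnWith
  set C₁ := |∑ i, normalJac (Pu x₀) i i| + 1 with hC₁
  set τ := (∑ i : Fin m, ∑ j, |pd m i (fun z => Pv z j) x₀|) + 1 with hτ
  set D := ‖x₀ - y'‖ + 1 with hD
  have hτ0 : 0 < τ := by positivity
  set k := (3 * C₁ + 3 * (L * τ * D)) / (4 * κ) + 1 with hk
  have hk1 : 1 ≤ k := by
    have : 0 ≤ (3 * C₁ + 3 * (L * τ * D)) / (4 * κ) := by positivity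
    linarith
  have hkκ : 3 * C₁ + 3 * (L * τ * D) < 4 * k * κ := by
    have : 4 * k * κ = 3 * C₁ + 3 * (L * τ * D) + 4 * κ := by
      rw [hk]; field_simp
    linarith
  have near : ∀ᶠ x in 𝓝 x₀, x ∈ U ∧ κ / 2 < Q x ∧ (∑ i, normalJac (Pu x) i i) < C₁ ∧
      (∑ i : Fin m, ∑ j, |pd m i (fun z => Pv z j) x|) < τ ∧ ‖x - y'‖ < D ∧
      Pu x ∈ sL ∧ Pv x ∈ sL ∧ |s x| < 1 / (4 * k) := by
    have hs1 : ContinuousAt (fun x => |s x|) x₀ := hsc.abs.continuousAt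
    filter_upwards [hU.mem_nhds hx₀, hQc.eventually_const_lt (half_lt_self hQ0),
      htrc.eventually_lt_const (lt_of_le_of_lt (le_abs_self _) (lt_add_one _)),
      hTc.eventually_lt_const (lt_add_one _), hDc.eventually_lt_const (lt_add_one _),
      hPuc.eventually hsL, hPvc.eventually (by rw [← hP0]; exact hsL),
      hs1.eventually_lt_const (show |s x₀| < 1 / (4 * k) by rw [hs0]; simp; positivity)]
      with x h1 h2 h3 h4 h5 h6 h7 h8
    exact ⟨h1, h2, h3, h4, h5, h6, h7, h8⟩
  obtain ⟨ρ, hρ, hball⟩ := Metric.nhds_basis_closedBall.mem_iff.1 near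
  have hsb : ∀ x ∈ Metric.closedBall x₀ ρ, 1 / 2 ≤ 1 + 2 * k * s x ∧ 1 + 2 * k * s x ≤ 3 / 2 ∧
      s x ≤ 1 / 4 := by
    intro x hx
    have h := (hball hx).2.2.2.2.2.2.2
    rw [abs_lt] at h
    have e : 2 * k * (1 / (4 * k)) = 1 / 2 := by field_simp; norm_num
    have h1 : 2 * k * s x ≤ 2 * k * (1 / (4 * k)) := by
      gcongr; exact h.2.le
    have h2 : 2 * k * -(1 / (4 * k)) ≤ 2 * k * s x := by
      gcongr; exact h.1.le
    have h3 : 1 / (4 * k) ≤ 1 / (4 * 1) := by gcongr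
    refine ⟨by linarith, by linarith, by linarith [h.2]⟩
  set S := Metric.sphere x₀ ρ ∩ {z | 0 ≤ s z} with hS
  have hScpt : IsCompact S :=
    (isCompact_sphere x₀ ρ).inter_right (isClosed_le continuous_const hsc)
  have hSU : S ⊆ U := fun z hz => (hball (Metric.sphere_subset_closedBall hz.1)).1
  obtain ⟨ε, hε, hεS⟩ := hScpt.exists_forall_le' (f := fun z => u z - v z) (a := 0)
    ((hu.continuousOn.sub hv.continuousOn).mono hSU) (by
      intro z hz
      refine sub_pos.2 (lt_of_le_of_ne (huv z (hSU hz)) fun h => ?_)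
      have hne : z ≠ x₀ := by
        rintro rfl
        have h := hz.1
        rw [Metric.mem_sphere, dist_self] at h
        exact hρ.ne h
      exact absurd hz.2 (not_le.2 (hsZ z (hSU hz) h.symm hne)))
  set Φ : (Fin m → ℝ) → ℝ := fun z => u z - v z - ε * (s z + k * s z ^ 2) with hΦ
  have hΦ0 : Φ x₀ = 0 := by simp [hΦ, hs0, htouch]
  have hΦS : ∀ z ∈ Metric.sphere x₀ ρ, 0 ≤ Φ z := by
    intro z hz
    have hzb := Metric.sphere_subset_closedBall hz
    obtain ⟨b1, b2, b3⟩ := hsb z hzb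
    have e : Φ z = u z - v z - ε * (s z * (1 + k * s z)) := by simp only [hΦ]; ring
    rw [e]
    by_cases h : 0 ≤ s z
    · have h1 : ε ≤ u z - v z := hεS z ⟨hz, h⟩
      have h2 : s z * (1 + k * s z) ≤ 1 := by nlinarith
      nlinarith
    · push Not at h
      have h1 := huv z (hball hzb).1
      have h2 : s z * (1 + k * s z) ≤ 0 := mul_nonpos_of_nonpos_of_nonneg h.le (by linarith)
      nlinarith
  have hUb : Metric.closedBall x₀ ρ ⊆ U := fun z hz => (hball hz).1
  obtain ⟨x₁, hx₁, hmin⟩ : ∃ x₁ ∈ Metric.ball x₀ ρ, IsMinOn Φ (Metric.closedBall x₀ ρ) x₁ := by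
    have hx₀b : x₀ ∈ Metric.closedBall x₀ ρ := Metric.mem_closedBall_self hρ.le
    obtain ⟨x₁, hx₁, hmin⟩ := (isCompact_closedBall x₀ ρ).exists_isMinOn ⟨x₀, hx₀b⟩
      (f := Φ) (((hu.continuousOn.sub hv.continuousOn).mono hUb).sub
        (Continuous.continuousOn (by fun_prop)))
    by_cases h : x₁ ∈ Metric.ball x₀ ρ
    · exact ⟨x₁, h, hmin⟩
    · have hsph : x₁ ∈ Metric.sphere x₀ ρ :=
        le_antisymm hx₁ (not_lt.1 h)
      refine ⟨x₀, Metric.mem_ball_self hρ, fun z hz => ?_⟩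
      have h1 := hΦS x₁ hsph
      have h2 : Φ x₁ ≤ Φ z := hmin hz
      simp only [mem_ofPred_eq]
      linarith
  have hx₁b := Metric.ball_subset_closedBall hx₁
  have hx₁U := hUb hx₁b
  have hloc : IsLocalMin Φ x₁ :=
    hmin.isLocalMin (Filter.mem_of_superset (Metric.isOpen_ball.mem_nhds hx₁)
      Metric.ball_subset_closedBall)
  obtain ⟨-, n2, n3, n4, n5, n6, n7, -⟩ := hball hx₁b
  obtain ⟨b1, b2, -⟩ := hsb x₁ hx₁b
  obtain ⟨t1, t2⟩ := barrier_test (f := fun z => u z - v z)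
    (G := fun j z => Pu z j - Pv z j) (x := x₁) (y := y') (ε := ε) (k := k) (c := c)
    (Filter.eventually_of_mem (hU.mem_nhds hx₁U) hwd)
    (fun j => (hdu x₁ hx₁U j).sub (hdv x₁ hx₁U j)) hloc
  change ∀ j, Pu x₁ j - Pv x₁ j = -2 * ε * (1 + 2 * k * s x₁) * (x₁ j - y' j) at t1
  change ∀ ξ : Fin m → ℝ, ε * (-2 * (1 + 2 * k * s x₁) * ∑ i, ξ i ^ 2
      + 8 * k * (∑ i, (x₁ i - y' i) * ξ i) ^ 2) ≤
      ∑ i : Fin m, ∑ j : Fin m, pd m i (fun z => Pu z j - Pv z j) x₁ * ξ i * ξ j at t2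
  have hpd : ∀ i j : Fin m, pd m i (fun z => Pu z j - Pv z j) x₁
      = pd m i (fun z => Pu z j) x₁ - pd m i (fun z => Pv z j) x₁ := by
    intro i j
    rw [pd, fderiv_fun_sub (hdu x₁ hx₁U j) (hdv x₁ hx₁U j)]
    rfl
  have hHx := hH x₁ hx₁U
  rw [Hmc_eq (hns_u x₁ hx₁U) (hdu x₁ hx₁U), Hmc_eq (hns_v x₁ hx₁U) (hdv x₁ hx₁U)] at hHx
  change ∑ i : Fin m, ∑ j : Fin m, normalJac (Pu x₁) i j * pd m i (fun z => Pu z j) x₁ ≤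
    ∑ i : Fin m, ∑ j : Fin m, normalJac (Pv x₁) i j * pd m i (fun z => Pv z j) x₁ at hHx
  have hpos := normalJac_trace_nonneg (hns_u x₁ hx₁U)
    (M := fun i j => pd m i (fun z => Pu z j - Pv z j) x₁
      - ε * (-2 * (1 + 2 * k * s x₁) * (if i = j then 1 else 0)
        + 8 * k * ((x₁ i - y' i) * (x₁ j - y' j)))) (by
      intro ξ
      have h := sub_nonneg.2 (t2 ξ)
      refine h.trans (le_of_eq ?_)
      exact (sum_sub_rank_one_mul _ (fun i => x₁ i - y' i) ξ _ _ _).symm)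
  have hE : ∑ i : Fin m, ∑ j : Fin m, normalJac (Pu x₁) i j * pd m i (fun z => Pu z j - Pv z j) x₁
      = ∑ i : Fin m, ∑ j : Fin m, normalJac (Pu x₁) i j * pd m i (fun z => Pu z j) x₁
        - ∑ i : Fin m, ∑ j : Fin m, normalJac (Pv x₁) i j * pd m i (fun z => Pv z j) x₁
        - ∑ i : Fin m, ∑ j : Fin m,
          (normalJac (Pu x₁) i j - normalJac (Pv x₁) i j) * pd m i (fun z => Pv z j) x₁ := by
    simp only [← sum_sub_distrib, hpd]
    exact sum_congr rfl fun i _ => sum_congr rfl fun j _ => by ring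
  have hsplit : ∑ i : Fin m, ∑ j : Fin m, normalJac (Pu x₁) i j *
      (pd m i (fun z => Pu z j - Pv z j) x₁
      - ε * (-2 * (1 + 2 * k * s x₁) * (if i = j then 1 else 0)
        + 8 * k * ((x₁ i - y' i) * (x₁ j - y' j)))) =
      ∑ i : Fin m, ∑ j : Fin m, normalJac (Pu x₁) i j * pd m i (fun z => Pu z j - Pv z j) x₁
      - ε * (-2 * (1 + 2 * k * s x₁) * (∑ i, normalJac (Pu x₁) i i) + 8 * k * Q x₁) :=
    sum_mul_sub_rank_one (normalJac (Pu x₁)) _ (fun i => x₁ i - y' i) _ _ _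
  rw [hsplit, hE] at hpos
  have hdiff : ‖Pu x₁ - Pv x₁‖ ≤ 3 * ε * D := by
    refine (pi_norm_le_iff_of_nonneg (by positivity)).2 fun j => ?_
    rw [Pi.sub_apply, t1 j, norm_mul, norm_mul, norm_mul, Real.norm_of_nonneg hε.le,
      Real.norm_of_nonneg (by linarith : 0 ≤ 1 + 2 * k * s x₁)]
    have h1 : ‖x₁ j - y' j‖ ≤ D := (norm_le_pi_norm (x₁ - y') j).trans n5.le
    have h2 : ‖(-2 : ℝ)‖ = 2 := by norm_num
    rw [h2]
    calc 2 * ε * (1 + 2 * k * s x₁) * ‖x₁ j - y' j‖ ≤ 2 * ε * (3 / 2) * D := by gcongr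
      _ = 3 * ε * D := by ring
  have hJd : ∀ i j, |normalJac (Pu x₁) i j - normalJac (Pv x₁) i j| ≤ L * (3 * ε * D) := by
    intro i j
    have h1 := (hL.norm_sub_le n6 n7).trans (mul_le_mul_of_nonneg_left hdiff L.2)
    exact ((norm_le_pi_norm ((normalJac (Pu x₁) - normalJac (Pv x₁)) i) j).trans
      (norm_le_pi_norm (normalJac (Pu x₁) - normalJac (Pv x₁)) i)).trans h1
  have hE2 : |∑ i : Fin m, ∑ j : Fin m,
      (normalJac (Pu x₁) i j - normalJac (Pv x₁) i j) * pd m i (fun z => Pv z j) x₁|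
      ≤ L * (3 * ε * D) * τ := by
    refine (abs_sum_le_sum_abs _ _).trans ?_
    refine le_trans ?_ (mul_le_mul_of_nonneg_left n4.le (by positivity))
    rw [mul_sum]
    refine sum_le_sum fun i _ => (abs_sum_le_sum_abs _ _).trans ?_
    rw [mul_sum]
    refine sum_le_sum fun j _ => ?_
    rw [abs_mul]
    exact mul_le_mul_of_nonneg_right (hJd i j) (abs_nonneg _)
  have htr : -2 * (1 + 2 * k * s x₁) * (∑ i, normalJac (Pu x₁) i i) ≥ -3 * C₁ := by
    have hC0 : 0 < C₁ := by positivity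
    nlinarith
  have hQk : 4 * k * κ ≤ 8 * k * Q x₁ := by nlinarith
  have hlow : 0 < ε * (-2 * (1 + 2 * k * s x₁) * (∑ i, normalJac (Pu x₁) i i) + 8 * k * Q x₁
      - 3 * (L * τ * D)) := mul_pos hε (by linarith)
  have habs := neg_le_of_abs_le hE2
  linarith

end Curvature

section Pairing

open scoped Topology

variable {m : ℕ}

theorem sum_sum_ite_lt_add_swap {f : Fin m → Fin m → ℝ} (hf : ∀ k, f k k = 0) :
    ∑ k : Fin m, ∑ j : Fin m, (if (k : ℕ) < (j : ℕ) then f k j + f j k else 0) =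
      ∑ k, ∑ j, f k j := by
  have h1 : ∑ k : Fin m, ∑ j : Fin m, (if (k : ℕ) < (j : ℕ) then f j k else 0) =
      ∑ k : Fin m, ∑ j : Fin m, if (j : ℕ) < (k : ℕ) then f k j else 0 := sum_comm
  have h2 : ∑ k : Fin m, ∑ j : Fin m, (if (k : ℕ) < (j : ℕ) then f k j + f j k else 0) =
      ∑ k : Fin m, ∑ j : Fin m, (if (k : ℕ) < (j : ℕ) then f k j else 0) +
        ∑ k : Fin m, ∑ j : Fin m, if (k : ℕ) < (j : ℕ) then f j k else 0 := by
    simp only [← sum_add_distrib]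
    refine sum_congr rfl fun k _ => sum_congr rfl fun j _ => ?_
    split_ifs <;> simp
  rw [h2, h1]
  simp only [← sum_add_distrib]
  refine sum_congr rfl fun k _ => sum_congr rfl fun j _ => ?_
  rcases lt_trichotomy k j with h | rfl | h
  · have h' : (k : ℕ) < j := h
    simp [h', h'.not_gt]
  · simp [hf]
  · have h' : (j : ℕ) < k := h
    simp [h', h'.not_gt]

theorem fderiv_apply_eq_sum_pd {F : (Fin m → ℝ) → (Fin m → ℝ)} {x : Fin m → ℝ}
    (hF : DifferentiableAt ℝ F x) (ξ : Fin m → ℝ) (j : Fin m) :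
    fderiv ℝ F x ξ j = ∑ k : Fin m, pd m k (fun y => F y j) x * ξ k := by
  simp only [pd]
  rw [← apply_eq_sum_pd, fderiv_apply hF]
  rfl

theorem curlPairing_eq {F : (Fin m → ℝ) → (Fin m → ℝ)} {x : Fin m → ℝ}
    (hF : DifferentiableAt ℝ F x) (Nw : Fin (m - 1) → ((Fin m → ℝ) → (Fin m → ℝ)))
    (α β : Fin (m - 1)) :
    curlPairing m F Nw α β x =
      ∑ j, fderiv ℝ F x (Nw α x) j * Nw β x j - ∑ j, fderiv ℝ F x (Nw β x) j * Nw α x j := by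
  set A : Fin m → Fin m → ℝ := fun k j => pd m k (fun y => F y j) x with hA
  have h := sum_sum_ite_lt_add_swap
    (f := fun k j => (A k j - A j k) * (Nw α x k * Nw β x j)) (by simp)
  have e : curlPairing m F Nw α β x =
      ∑ k, ∑ j, (A k j - A j k) * (Nw α x k * Nw β x j) := by
    rw [← h, curlPairing]
    refine sum_congr rfl fun k _ => sum_congr rfl fun j _ => ?_
    refine if_congr Iff.rfl ?_ rfl
    simp only [hA]
    ring
  have e1 : ∑ j, fderiv ℝ F x (Nw α x) j * Nw β x j =
      ∑ k, ∑ j, A k j * (Nw α x k * Nw β x j) := by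
    rw [sum_comm]
    refine sum_congr rfl fun j _ => ?_
    rw [fderiv_apply_eq_sum_pd hF, sum_mul]
    exact sum_congr rfl fun k _ => by ring
  have e2 : ∑ j, fderiv ℝ F x (Nw β x) j * Nw α x j =
      ∑ k, ∑ j, A j k * (Nw α x k * Nw β x j) := by
    refine sum_congr rfl fun j _ => ?_
    rw [fderiv_apply_eq_sum_pd hF, sum_mul]
    exact sum_congr rfl fun k _ => by ring
  rw [e, e1, e2]
  simp only [← sum_sub_distrib]
  exact sum_congr rfl fun k _ => sum_congr rfl fun j _ => by ring

theorem sum_fderiv_mul_of_orthogonal {X P : (Fin m → ℝ) → (Fin m → ℝ)} {x : Fin m → ℝ}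
    (hX : DifferentiableAt ℝ X x) (hP : DifferentiableAt ℝ P x)
    (hXP : ∀ᶠ y in 𝓝 x, ∑ i, X y i * P y i = 0) (ξ : Fin m → ℝ) :
    ∑ i, fderiv ℝ X x ξ i * P x i = -∑ i, fderiv ℝ P x ξ i * X x i := by
  have h : HasFDerivAt (fun y => ∑ i, X y i * P y i) _ x := HasFDerivAt.fun_sum fun i _ =>
    (hasFDerivAt_pi'.1 hX.hasFDerivAt i).mul (hasFDerivAt_pi'.1 hP.hasFDerivAt i)
  have h0 : HasFDerivAt (fun y => ∑ i, X y i * P y i) (0 : (Fin m → ℝ) →L[ℝ] ℝ) x :=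
    (hasFDerivAt_const 0 x).congr_of_eventuallyEq hXP
  have e := congrArg (fun L : (Fin m → ℝ) →L[ℝ] ℝ => L ξ) (h.unique h0)
  simp only [_root_.sum_apply, _root_.add_apply, _root_.smul_apply,
    ContinuousLinearMap.comp_apply, ContinuousLinearMap.proj_apply, smul_eq_mul,
    sum_add_distrib, _root_.zero_apply] at e
  rw [eq_neg_iff_add_eq_zero, add_comm, ← e]
  congr 1 <;> exact sum_congr rfl fun i _ => by ring

theorem fderiv_gradF_apply {F : (Fin m → ℝ) → (Fin m → ℝ)} {w : (Fin m → ℝ) → ℝ}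
    {x : Fin m → ℝ} (hF : DifferentiableAt ℝ F x) (hw : ContDiffAt ℝ 2 w x)
    (ξ : Fin m → ℝ) (i : Fin m) :
    fderiv ℝ (gradF m F w) x ξ i = fderiv ℝ (fderiv ℝ w) x ξ (ee m i) + fderiv ℝ F x ξ i := by
  have hD : HasFDerivAt (fderiv ℝ w) (fderiv ℝ (fderiv ℝ w) x) x :=
    ((hw.fderiv_right (m := 1) (by norm_num)).differentiableAt (by norm_num)).hasFDerivAt
  have h : HasFDerivAt (gradF m F w) (ContinuousLinearMap.pi fun i : Fin m =>
      (fderiv ℝ (fderiv ℝ w) x).flip (ee m i)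
        + (ContinuousLinearMap.proj i).comp (fderiv ℝ F x)) x := by
    refine hasFDerivAt_pi.2 fun i => ?_
    refine HasFDerivAt.add ?_ (hasFDerivAt_pi'.1 hF.hasFDerivAt i)
    have h := hD.clm_apply (hasFDerivAt_const (ee m i) x)
    simp only [ContinuousLinearMap.comp_zero, zero_add] at h
    exact h
  rw [h.fderiv]
  simp

/-- If `X` and `Y` are orthogonal to `∇w + F`, then so is `[X, Y]` up to the curl of `F`. -/
theorem sum_bracket_mul_gradF {F : (Fin m → ℝ) → (Fin m → ℝ)} {w : (Fin m → ℝ) → ℝ}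
    {x : Fin m → ℝ} (hF : ContDiffAt ℝ 1 F x) (hw : ContDiffAt ℝ 2 w x)
    {X Y : (Fin m → ℝ) → (Fin m → ℝ)} (hX : DifferentiableAt ℝ X x) (hY : DifferentiableAt ℝ Y x)
    (hXP : ∀ᶠ y in 𝓝 x, ∑ i, X y i * gradF m F w y i = 0)
    (hYP : ∀ᶠ y in 𝓝 x, ∑ i, Y y i * gradF m F w y i = 0)
    (hP : DifferentiableAt ℝ (gradF m F w) x) :
    ∑ i, (fderiv ℝ Y x (X x) - fderiv ℝ X x (Y x)) i * gradF m F w x i =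
      -(∑ j, fderiv ℝ F x (X x) j * Y x j - ∑ j, fderiv ℝ F x (Y x) j * X x j) := by
  have hFd := hF.differentiableAt (by norm_num)
  simp only [Pi.sub_apply, sub_mul, sum_sub_distrib]
  rw [sum_fderiv_mul_of_orthogonal hY hP hYP, sum_fderiv_mul_of_orthogonal hX hP hXP]
  simp only [fderiv_gradF_apply hFd hw, add_mul, sum_add_distrib]
  rw [← apply_eq_sum_pd, ← apply_eq_sum_pd,
    (hw.isSymmSndFDerivAt (by simp)).eq (X x) (Y x)]
  ring

end Pairing

section Conclusion

open scoped RealInnerProductSpace Topology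

variable {m : ℕ}

/-- `isOpen_of_proximal_normals` in coordinates. -/
theorem isOpen_of_proximal_normals_pi {U Z : Set (Fin m → ℝ)} (hU : IsOpen U) (hZU : Z ⊆ U)
    (hZ : closure Z ∩ U ⊆ Z) {X Y P : (Fin m → ℝ) → (Fin m → ℝ)}
    (hX : ContDiffOn ℝ 1 X U) (hY : ContDiffOn ℝ 1 Y U)
    (hP : ∀ y, ∀ z ∈ Z, (∀ z' ∈ Z, ∑ i, (y i - z i) ^ 2 ≤ ∑ i, (y i - z' i) ^ 2) →
      ∃ c : ℝ, y - z = c • P z)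
    (hXP : ∀ z ∈ Z, ∑ i, X z i * P z i = 0) (hYP : ∀ z ∈ Z, ∑ i, Y z i * P z i = 0)
    (hXY : ∀ z ∈ Z, ∑ i, (fderiv ℝ Y z (X z) - fderiv ℝ X z (Y z)) i * P z i ≠ 0) :
    IsOpen Z := by
  set φ : EuclideanSpace ℝ (Fin m) ≃L[ℝ] (Fin m → ℝ) := EuclideanSpace.equiv (Fin m) ℝ with hφ
  have hφi : ∀ x i, φ x i = x i := fun x i => rfl
  have hψi : ∀ x i, φ.symm x i = x i := fun x i => rfl
  have hinner : ∀ x y : EuclideanSpace ℝ (Fin m), ⟪x, y⟫ = ∑ i, x i * y i := fun x y => by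
    rw [PiLp.inner_apply]
    exact sum_congr rfl fun i _ => by simp [mul_comm]
  have hdist : ∀ x y : EuclideanSpace ℝ (Fin m), ‖x - y‖ ^ 2 = ∑ i, (φ x i - φ y i) ^ 2 :=
    fun x y => by rw [EuclideanSpace.real_norm_sq_eq]; rfl
  have hcd : ∀ {X : (Fin m → ℝ) → (Fin m → ℝ)}, ContDiffOn ℝ 1 X U →
      ContDiffOn ℝ 1 (fun x => φ.symm (X (φ x))) (φ ⁻¹' U) := fun {X} h =>
    φ.symm.contDiff.comp_contDiffOn (h.comp φ.contDiff.contDiffOn (mapsTo_preimage φ U))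
  have hfd : ∀ {X : (Fin m → ℝ) → (Fin m → ℝ)}, ContDiffOn ℝ 1 X U → ∀ x, φ x ∈ U → ∀ ξ,
      fderiv ℝ (fun x => φ.symm (X (φ x))) x ξ = φ.symm (fderiv ℝ X (φ x) (φ ξ)) := by
    intro X h x hx ξ
    have h1 : HasFDerivAt X (fderiv ℝ X (φ x)) (φ x) :=
      ((h.contDiffAt (hU.mem_nhds hx)).differentiableAt (by norm_num)).hasFDerivAt
    have h2 := φ.symm.hasFDerivAt.comp x (h1.comp x φ.hasFDerivAt)
    exact congrArg (fun L => L ξ) h2.fderiv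
  have key : IsOpen (φ ⁻¹' Z) := by
    refine isOpen_of_proximal_normals (hU.preimage φ.continuous) (preimage_mono hZU) ?_
      (hcd hX) (hcd hY) (P := fun x => φ.symm (P (φ x))) ?_ ?_ ?_ ?_
    · rintro x ⟨hx, hxU⟩
      exact hZ ⟨φ.continuous.closure_preimage_subset Z hx, hxU⟩
    · rintro y z ⟨hz, hmin⟩
      obtain ⟨c, hc⟩ := hP (φ y) (φ z) hz fun z' hz' => by
        have h := hmin (φ.symm z') (by simpa using hz')
        have h2 := pow_le_pow_left₀ (norm_nonneg _) h 2
        rw [hdist, hdist] at h2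
        simpa using h2
      exact ⟨c, φ.injective (by simpa using hc)⟩
    · intro z hz
      rw [hinner]
      exact hXP _ hz
    · intro z hz
      rw [hinner]
      exact hYP _ hz
    · intro z hz
      rw [real_inner_comm, hinner, hfd hX z (hZU hz), hfd hY z (hZU hz)]
      simp only [φ.apply_symm_apply]
      exact hXY _ hz
  have := key.preimage φ.symm.continuous
  rwa [← preimage_comp, show φ ∘ φ.symm = id from funext φ.apply_symm_apply, preimage_id] at this

theorem OrthFrame.sum_mul_gradF {U : Set (Fin m → ℝ)} {F : (Fin m → ℝ) → (Fin m → ℝ)}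
    {w : (Fin m → ℝ) → ℝ} {Nw : Fin (m - 1) → ((Fin m → ℝ) → (Fin m → ℝ))}
    (h : OrthFrame m U F w Nw) {x : Fin m → ℝ} (hx : x ∈ U) (hns : gradF m F w x ≠ 0)
    (α : Fin (m - 1)) : ∑ i, Nw α x i * gradF m F w x i = 0 := by
  have hR : √(∑ k, gradF m F w x k ^ 2) ≠ 0 := (Real.sqrt_pos.2 (sum_sq_pos hns)).ne'
  have e := h.2.2 x hx α
  simp only [legN, ← mul_div_assoc, ← sum_div] at e
  simpa [hR] using e

theorem isOpen_coincidence_of_curlPairing_ne_zero {U : Set (Fin m → ℝ)} (hU : IsOpen U)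
    {F : (Fin m → ℝ) → (Fin m → ℝ)} (hF : ContDiffOn ℝ 1 F U) {w : (Fin m → ℝ) → ℝ}
    (hw : ContDiffOn ℝ 2 w U) (hns : ∀ x ∈ U, gradF m F w x ≠ 0)
    {Nw : Fin (m - 1) → ((Fin m → ℝ) → (Fin m → ℝ))} (hN : OrthFrame m U F w Nw)
    {α β : Fin (m - 1)} (hcurl : ∀ x ∈ U, curlPairing m F Nw α β x ≠ 0)
    {Z : Set (Fin m → ℝ)} (hZU : Z ⊆ U) (hZ : closure Z ∩ U ⊆ Z)
    (hP : ∀ y, ∀ z ∈ Z, (∀ z' ∈ Z, ∑ i, (y i - z i) ^ 2 ≤ ∑ i, (y i - z' i) ^ 2) →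
      ∃ c : ℝ, y - z = c • gradF m F w z) : IsOpen Z := by
  have hC : ∀ α, ContDiffOn ℝ 1 (Nw α) U := fun α => (hN.1 α).of_le (by exact_mod_cast le_top)
  have hd : ∀ {X : (Fin m → ℝ) → (Fin m → ℝ)}, ContDiffOn ℝ 1 X U → ∀ x ∈ U,
      DifferentiableAt ℝ X x := fun h x hx =>
    (h.contDiffAt (hU.mem_nhds hx)).differentiableAt (by norm_num)
  have h0 : ∀ α, ∀ x ∈ U, ∑ i, Nw α x i * gradF m F w x i = 0 := fun α x hx =>
    hN.sum_mul_gradF hx (hns x hx) α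
  refine isOpen_of_proximal_normals_pi hU hZU hZ (hC α) (hC β) hP
    (fun z hz => h0 α z (hZU hz)) (fun z hz => h0 β z (hZU hz)) fun z hz => ?_
  have hzU := hZU hz
  have hev : ∀ α, ∀ᶠ y in 𝓝 z, ∑ i, Nw α y i * gradF m F w y i = 0 := fun α =>
    Filter.eventually_of_mem (hU.mem_nhds hzU) (h0 α)
  rw [sum_bracket_mul_gradF (hF.contDiffAt (hU.mem_nhds hzU)) (hw.contDiffAt (hU.mem_nhds hzU))
    (hd (hC α) z hzU) (hd (hC β) z hzU) (hev α) (hev β) (hd (contDiffOn_gradF hU hF hw) z hzU),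
    ← curlPairing_eq (hd hF z hzU)]
  exact neg_ne_zero.2 (hcurl z hzU)

end Conclusion

/-- Corollary G: strong maximum principle for `H_F` under the
nonvanishing-curl-pairing condition. -/
theorem strong_max_principle_curl_pairing
    (m : ℕ) (hm : 3 ≤ m)
    (U : Set (Fin m → ℝ)) (hUopen : IsOpen U) (hUconn : IsConnected U)
    (F : (Fin m → ℝ) → (Fin m → ℝ)) (hF : ContDiffOn ℝ 1 F U)
    (u v : (Fin m → ℝ) → ℝ)
    (hu : ContDiffOn ℝ 2 u U) (hv : ContDiffOn ℝ 2 v U)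
    (hns_u : ∀ x ∈ U, gradF m F u x ≠ 0)
    (hns_v : ∀ x ∈ U, gradF m F v x ≠ 0)
    (hH : ∀ x ∈ U, Hmc m F u x ≤ Hmc m F v x)
    (huv : ∀ x ∈ U, v x ≤ u x)
    (p₀ : Fin m → ℝ) (hp₀ : p₀ ∈ U) (htouch : u p₀ = v p₀)
    (Nv Nu : Fin (m - 1) → ((Fin m → ℝ) → (Fin m → ℝ)))
    (hNv : OrthFrame m U F v Nv) (hNu : OrthFrame m U F u Nu)
    (hcurl : (∃ α β, α ≠ β ∧ ∀ x ∈ U, curlPairing m F Nv α β x ≠ 0) ∨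
             (∃ α β, α ≠ β ∧ ∀ x ∈ U, curlPairing m F Nu α β x ≠ 0)) :
    ∀ x ∈ U, u x = v x := by
  set Z : Set (Fin m → ℝ) := {x | x ∈ U ∧ u x = v x} with hZdef
  have hZU : Z ⊆ U := fun x hx => hx.1
  have hZ : closure Z ∩ U ⊆ Z := by
    rintro x ⟨hx, hxU⟩
    refine ⟨hxU, ?_⟩
    have hux := (hu.contDiffAt (hUopen.mem_nhds hxU)).continuousAt
    have hvx := (hv.contDiffAt (hUopen.mem_nhds hxU)).continuousAt
    have : (nhdsWithin x Z).NeBot := mem_closure_iff_nhdsWithin_neBot.1 hx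
    exact tendsto_nhds_unique_of_eventuallyEq (hux.mono_left nhdsWithin_le_nhds)
      (hvx.mono_left nhdsWithin_le_nhds)
      (Filter.eventually_of_mem self_mem_nhdsWithin fun y (hy : y ∈ Z) => hy.2)
  have hpar : ∀ y, ∀ z ∈ Z, (∀ z' ∈ Z, ∑ i, (y i - z i) ^ 2 ≤ ∑ i, (y i - z' i) ^ 2) →
      gradF m F u z = gradF m F v z ∧ ∃ c : ℝ, y - z = c • gradF m F u z := fun y z hz hmin =>
    proximal_normal_parallel hUopen hF hu hv hns_u hns_v hH huv hz.1 hz.2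
      fun z' hz' he => hmin z' ⟨hz', he⟩
  have hopen : IsOpen Z := by
    obtain ⟨α, β, -, h⟩ | ⟨α, β, -, h⟩ := hcurl
    · refine isOpen_coincidence_of_curlPairing_ne_zero hUopen hF hv hns_v hNv h hZU hZ ?_
      intro y z hz hmin
      obtain ⟨e, c, hc⟩ := hpar y z hz hmin
      exact ⟨c, e ▸ hc⟩
    · exact isOpen_coincidence_of_curlPairing_ne_zero hUopen hF hu hns_u hNu h hZU hZ
        fun y z hz hmin => (hpar y z hz hmin).2
  have hsub : U ⊆ Z := hUconn.isPreconnected.subset_of_closure_inter_subset hopen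
    ⟨p₀, hp₀, hp₀, htouch⟩ hZ
  exact fun x hx => (hsub hx).2
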